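/- Let l be a positive integer, and let r, μ, r_1, ..., r_l, μ_1, ..., μ_l be positive real numbers satisfying: (1) r = r_1 + ⋯ + r_l; (2) μ_1 > μ_2 > ⋯ > μ_l ≥ 0; (3) rμ = r_1 μ_1 + ⋯ + r_l μ_l. Then the inequality Σ_{1 ≤ i < j ≤ l} r_i r_j (μ_i − μ_j)² ≤ r² (μ_1 − μ)(μ − μ_l) holds. Moreover, if equality holds, then l ≤ 2. -/

import Mathlib

/-- Lagrange's identity for weighted variances: the weighted sum of squared differences over
pairs `i < j`, written through the first two moments. -/
theorem sum_lt_mul_sub_sq {ι : Type*} [Fintype ι] [LinearOrder ι] (w x : ι → ℝ) :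
    (∑ i, ∑ j, if i < j then w i * w j * (x i - x j) ^ 2 else 0)
      = (∑ i, w i) * (∑ i, w i * x i ^ 2) - (∑ i, w i * x i) ^ 2 := by
  set S := ∑ i, ∑ j, if i < j then w i * w j * (x i - x j) ^ 2 else 0 with hS
  have hswap : S = ∑ i, ∑ j, if j < i then w i * w j * (x i - x j) ^ 2 else 0 := by
    rw [hS, Finset.sum_comm]
    refine Finset.sum_congr rfl fun i _ => Finset.sum_congr rfl fun j _ => ?_
    split_ifs <;> ring
  have hfull : S + S = ∑ i, ∑ j, w i * w j * (x i - x j) ^ 2 := by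
    nth_rewrite 2 [hswap]
    rw [hS, ← Finset.sum_add_distrib]
    refine Finset.sum_congr rfl fun i _ => ?_
    rw [← Finset.sum_add_distrib]
    refine Finset.sum_congr rfl fun j _ => ?_
    rcases lt_trichotomy i j with h | rfl | h
    · simp [h, h.not_gt]
    · simp
    · simp [h, h.not_gt]
  have hexp : ∑ i, ∑ j, w i * w j * (x i - x j) ^ 2
      = (∑ i, w i * x i ^ 2) * (∑ j, w j) + (∑ i, w i) * (∑ j, w j * x j ^ 2)
        - 2 * ((∑ i, w i * x i) * (∑ j, w j * x j)) := by
    rw [Finset.sum_mul_sum, Finset.sum_mul_sum, Finset.sum_mul_sum]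
    simp only [Finset.mul_sum, ← Finset.sum_add_distrib, ← Finset.sum_sub_distrib]
    refine Finset.sum_congr rfl fun i _ => Finset.sum_congr rfl fun j _ => ?_
    ring
  linarith


/-- **Lemma 3.2 (a numerical inequality).**
Let `l ≥ 1` and let `r, μ, r₁, …, r_l, μ₁, …, μ_l` be positive real numbers
(with `μ_l ≥ 0` allowed) satisfying
(1) `r = r₁ + ⋯ + r_l`;
(2) `μ₁ > μ₂ > ⋯ > μ_l ≥ 0`;
(3) `r μ = r₁ μ₁ + ⋯ + r_l μ_l`.
Then `∑_{1 ≤ i < j ≤ l} r_i r_j (μ_i − μ_j)² ≤ r² (μ₁ − μ)(μ − μ_l)`.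
Moreover, if equality holds, then `l ≤ 2`. -/
theorem numerical_lemma (l : ℕ) (hl : 0 < l)
    (r μ : ℝ) (rs μs : Fin l → ℝ)
    (hr : 0 < r) (hμ : 0 < μ)
    (hrs : ∀ i, 0 < rs i)
    (hanti : StrictAnti μs)
    (hlast : 0 ≤ μs ⟨l - 1, by omega⟩)
    (hsum : r = ∑ i, rs i)
    (hwsum : r * μ = ∑ i, rs i * μs i) :
    (∑ i : Fin l, ∑ j : Fin l,
        if i < j then rs i * rs j * (μs i - μs j) ^ 2 else 0)
      ≤ r ^ 2 * (μs ⟨0, hl⟩ - μ) * (μ - μs ⟨l - 1, by omega⟩) ∧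
    ((∑ i : Fin l, ∑ j : Fin l,
        if i < j then rs i * rs j * (μs i - μs j) ^ 2 else 0)
      = r ^ 2 * (μs ⟨0, hl⟩ - μ) * (μ - μs ⟨l - 1, by omega⟩) → l ≤ 2) := by
  set M := μs ⟨0, hl⟩ with hM
  set m := μs ⟨l - 1, by omega⟩ with hm
  have hgap : r ^ 2 * (M - μ) * (μ - m)
      - (∑ i : Fin l, ∑ j : Fin l, if i < j then rs i * rs j * (μs i - μs j) ^ 2 else 0)
      = r * ∑ i, rs i * ((M - μs i) * (μs i - m)) := by
    have hexp : ∑ i, rs i * ((M - μs i) * (μs i - m))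
        = (M + m) * (∑ i, rs i * μs i) - M * m * (∑ i, rs i) - ∑ i, rs i * μs i ^ 2 := by
      simp only [Finset.mul_sum, ← Finset.sum_sub_distrib]
      exact Finset.sum_congr rfl fun i _ => by ring
    rw [sum_lt_mul_sub_sq, hexp, ← hsum, ← hwsum]
    ring
  have hnonneg : ∀ i ∈ Finset.univ, 0 ≤ rs i * ((M - μs i) * (μs i - m)) := fun i _ => by
    have h₁ : μs i ≤ M := hanti.antitone (Fin.mk_le_of_le_val (Nat.zero_le _))
    have h₂ : m ≤ μs i := hanti.antitone (Fin.le_def.2 (Nat.le_sub_one_of_lt i.isLt))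
    exact mul_nonneg (hrs i).le (mul_nonneg (sub_nonneg.2 h₁) (sub_nonneg.2 h₂))
  refine ⟨?_, fun heq => ?_⟩
  · have := mul_nonneg hr.le (Finset.sum_nonneg hnonneg)
    linarith
  · by_contra! hl2
    have h₁ : μs ⟨1, by omega⟩ < M := hanti (Fin.mk_lt_mk.2 one_pos)
    have h₂ : m < μs ⟨1, by omega⟩ := hanti (Fin.mk_lt_mk.2 (by omega))
    have hpos : 0 < ∑ i, rs i * ((M - μs i) * (μs i - m)) :=
      Finset.sum_pos' hnonneg ⟨⟨1, by omega⟩, Finset.mem_univ _,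
        mul_pos (hrs _) (mul_pos (sub_pos.2 h₁) (sub_pos.2 h₂))⟩
    have := mul_pos hr hpos
    linarith
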